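/- Let G = (V, E) be a finite multigraph whose edge set is partitioned into red edges E_R and blue edges E_B. Suppose that in each of the monochromatic subgraphs G_R (red edges only) and G_B (blue edges only), every vertex of V has nonzero even degree (a self-loop contributing degree 2). Suppose also that E decomposes as a disjoint union of m nonempty cycles S₁, ..., S_m, each of even length, whose edges alternate between red and blue. Then the numbers of connected components satisfy c(G_R) + c(G_B) ≤ |E|/2 - m + 2·c(G). -/

import Mathlib

/-- Degree of a vertex `v` in the sub-multigraph consisting of the edges
satisfying `S`, where a self-loop at `v` contributes `2`. -/
def multigraphDeg {V E : Type*} [Fintype E] [DecidableEq V]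
    (ends : E → Sym2 V) (S : E → Prop) [DecidablePred S] (v : V) : ℕ :=
  ∑ e : E, if S e then (if ends e = s(v, v) then 2 else if v ∈ ends e then 1 else 0) else 0

/-- Number of connected components (on the full vertex set `V`) of the
sub-multigraph consisting of the edges satisfying `S`. -/
noncomputable def multigraphComponents {V E : Type*} (ends : E → Sym2 V)
    (S : E → Prop) : ℕ :=
  Nat.card (Quotient (Relation.EqvGen.setoid
    (fun u v : V => ∃ e, S e ∧ ends e = s(u, v))))

section Helpers

/-- functions on `P` invariant along the arcs selected by `T` -/
def invSub {D P : Type*} (π : D → P) (σ : D → D) (T : D → Prop) :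
    Submodule (ZMod 2) (P → ZMod 2) where
  carrier := {h | ∀ d, T d → h (π d) = h (π (σ d))}
  add_mem' := by
    intro a b ha hb d hd
    simp [ha d hd, hb d hd]
  zero_mem' := by intro d _; rfl
  smul_mem' := by
    intro c a ha d hd
    simp [ha d hd]

/-- functions on `P` factoring through `q` -/
def facSub {P V : Type*} (q : P → V) : Submodule (ZMod 2) (P → ZMod 2) where
  carrier := {h | ∀ p p', q p = q p' → h p = h p'}
  add_mem' := by
    intro a b ha hb p p' hd
    simp [ha p p' hd, hb p p' hd]
  zero_mem' := by intro d _ _; rfl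
  smul_mem' := by
    intro c a ha p p' hd
    simp [ha p p' hd]

/-- The boundary map on faces. -/
def bdry {D P A : Type*} (e : D ≃ P × Bool) (φ : D → A) :
    (A → ZMod 2) →ₗ[ZMod 2] (P → ZMod 2) where
  toFun f p := f (φ (e.symm (p, true))) + f (φ (e.symm (p, false)))
  map_add' f g := by ext p; simp; ring
  map_smul' c f := by ext p; simp; ring

lemma sum_zero {D P A : Type*} [Fintype D] [Fintype P] (e : D ≃ P × Bool) (σ : D ≃ D)
    (φ : D → A) (hφ : ∀ d, φ (σ d) = φ d) (col : D → Bool) (hcol : ∀ d, col (σ d) = !col d)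
    (b : Bool) (f : A → ZMod 2) (h : P → ZMod 2)
    (hh : h ∈ invSub (fun d => (e d).1) σ (fun d => col d = b)) :
    ∑ p, bdry e φ f p * h p = 0 := by
  have h1 : ∑ p, bdry e φ f p * h p = ∑ d, f (φ d) * h (e d).1 := by
    rw [← e.symm.sum_comp, Fintype.sum_prod_type]
    refine Finset.sum_congr rfl fun p _ => ?_
    simp [bdry, add_mul]
  rw [h1]
  have h2 : ∑ d, f (φ d) * h (e d).1 =
      ∑ d, (if col d = b then f (φ d) * h (e d).1 else 0) +
      ∑ d, (if col d = b then 0 else f (φ d) * h (e d).1) := by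
    rw [← Finset.sum_add_distrib]
    refine Finset.sum_congr rfl fun d _ => ?_
    split_ifs <;> simp
  rw [h2, ← σ.sum_comp (fun d => if col d = b then 0 else f (φ d) * h (e d).1),
    ← Finset.sum_add_distrib]
  refine Finset.sum_eq_zero fun d _ => ?_
  have := hh d
  by_cases hb : col d = b
  · have h3 := this hb
    have h4 : ¬ (col (σ d) = b) := by rw [hcol, ← hb]; simp
    simp only [hb, h4, if_true, if_false, hφ]
    simp only at h3
    rw [h3]
    exact CharTwo.add_self_eq_zero _
  · have h4 : (col (σ d) = b) := by
      rw [hcol]; revert hb; cases col d <;> cases b <;> simp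
    simp [hb, h4]

lemma finrank_perp {P : Type*} [Fintype P] (Z U : Submodule (ZMod 2) (P → ZMod 2))
    (h : ∀ z ∈ Z, ∀ u ∈ U, ∑ p, z p * u p = 0) :
    Module.finrank (ZMod 2) Z + Module.finrank (ZMod 2) U ≤ Fintype.card P := by
  classical
  have h1 := Subspace.finrank_add_finrank_dualAnnihilator_eq (K := ZMod 2) U
  rw [Module.finrank_fintype_fun_eq_card] at h1
  have h2 : Z.map (dotProductEquiv (ZMod 2) P).toLinearMap ≤ U.dualAnnihilator := by
    rintro _ ⟨z, hz, rfl⟩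
    rw [Submodule.mem_dualAnnihilator]
    intro u hu
    exact h z hz u hu
  have h3 := Submodule.finrank_mono h2
  have h4 : Module.finrank (ZMod 2) ↥(Z.map (dotProductEquiv (ZMod 2) P).toLinearMap) =
      Module.finrank (ZMod 2) Z := LinearEquiv.finrank_map_eq _ _
  omega

lemma core {D P A : Type*} [Fintype D] [Fintype P] [Fintype A] (e : D ≃ P × Bool) (σ : D ≃ D)
    (φ : D → A) (hφs : Function.Surjective φ)
    (hφ : ∀ d, φ (σ d) = φ d) (col : D → Bool) (hcol : ∀ d, col (σ d) = !col d)
    (K : Submodule (ZMod 2) (P → ZMod 2)) :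
    Module.finrank (ZMod 2)
        ↥(invSub (fun d => (e d).1) σ (fun d => col d = true) ⊓ K) +
      Module.finrank (ZMod 2)
        ↥(invSub (fun d => (e d).1) σ (fun d => col d = false) ⊓ K) + Fintype.card A
    ≤ Fintype.card P + 2 * Module.finrank (ZMod 2)
        ↥(invSub (fun d => (e d).1) σ (fun _ => True) ⊓ K) := by
  set R := invSub (fun d => (e d).1) σ (fun d => col d = true)
  set B := invSub (fun d => (e d).1) σ (fun d => col d = false)
  have hG : invSub (fun d => (e d).1) σ (fun _ => True) = R ⊓ B := by
    ext h
    constructor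
    · intro hh
      exact ⟨fun d _ => hh d trivial, fun d _ => hh d trivial⟩
    · rintro ⟨h1, h2⟩ d _
      cases hc : col d
      · exact h2 d hc
      · exact h1 d hc
  rw [hG]
  have sub : ∀ X Y : Submodule (ZMod 2) (P → ZMod 2), Y ≤ X →
      Module.finrank (ZMod 2) ↥(X ⊓ K) + Module.finrank (ZMod 2) Y ≤
      Module.finrank (ZMod 2) X + Module.finrank (ZMod 2) ↥(Y ⊓ K) := by
    intro X Y hYX
    have h1 := Submodule.finrank_sup_add_finrank_inf_eq (X ⊓ K) Y
    have h2 : X ⊓ K ⊔ Y ≤ X := sup_le inf_le_left hYX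
    have h3 : X ⊓ K ⊓ Y ≤ Y ⊓ K := le_inf inf_le_right (inf_le_left.trans inf_le_right)
    have := Submodule.finrank_mono h2
    have := Submodule.finrank_mono h3
    omega
  have s1 := sub R (R ⊓ B) inf_le_left
  have s2 := sub B (R ⊓ B) inf_le_right
  have s3 := Submodule.finrank_sup_add_finrank_inf_eq R B
  have s4 := finrank_perp (LinearMap.range (bdry e φ)) (R ⊔ B) (by
    rintro _ ⟨f, rfl⟩ u hu
    obtain ⟨x, hx, y, hy, rfl⟩ := Submodule.mem_sup.1 hu
    have a1 := sum_zero e σ φ hφ col hcol true f x hx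
    have a2 := sum_zero e σ φ hφ col hcol false f y hy
    simp only [Pi.add_apply, mul_add, Finset.sum_add_distrib, a1, a2, add_zero])
  have s5 := LinearMap.finrank_range_add_finrank_ker (bdry e φ)
  rw [Module.finrank_fintype_fun_eq_card] at s5
  have s6 : Module.finrank (ZMod 2) (LinearMap.ker (bdry e φ)) ≤
      Module.finrank (ZMod 2) ↥(R ⊓ B) := by
    have key : ∀ f ∈ LinearMap.ker (bdry e φ), ∀ d, f (φ (e.symm ((e d).1, true))) = f (φ d) := by
      intro f hf d
      have := congrFun (LinearMap.mem_ker.1 hf) (e d).1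
      have h5 : f (φ (e.symm ((e d).1, true))) = f (φ (e.symm ((e d).1, false))) := by
        have := CharTwo.add_eq_zero.1 this
        exact this
      cases hb : (e d).2
      · rw [h5, ← hb]; simp
      · rw [← hb]; simp
    rw [← hG]
    let L : LinearMap.ker (bdry e φ) →ₗ[ZMod 2] invSub (fun d => (e d).1) σ (fun _ => True) :=
      { toFun := fun f => ⟨fun p => f.1 (φ (e.symm (p, true))), by
          intro d _
          simp only
          rw [key f.1 f.2, key f.1 f.2, hφ]⟩
        map_add' := fun f g => rfl
        map_smul' := fun c f => rfl }
    refine LinearMap.finrank_le_finrank_of_injective (f := L) ?_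
    intro f g hfg
    ext a
    obtain ⟨d, rfl⟩ := hφs a
    rw [← key f.1 f.2, ← key g.1 g.2]
    exact congrFun (congrArg Subtype.val hfg) (e d).1
  omega

lemma comp_finrank {D P V E : Type*} [Fintype P] [Finite V] (π : D → P) (σ : D → D)
    (q : P → V) (hq : Function.Surjective q) (ends : E → Sym2 V) (c : D → E)
    (hc : Function.Surjective c) (hends : ∀ d, ends (c d) = s(q (π d), q (π (σ d))))
    (S : E → Prop) :
    multigraphComponents ends S =
      Module.finrank (ZMod 2) ↥(invSub π σ (fun d => S (c d)) ⊓ facSub q) := by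
  classical
  set st := (Relation.EqvGen.setoid (fun u v : V => ∃ e, S e ∧ ends e = s(u, v)))
  have : Fintype (Quotient st) := Fintype.ofFinite _
  let L : (Quotient st → ZMod 2) →ₗ[ZMod 2] (P → ZMod 2) :=
    LinearMap.funLeft (ZMod 2) (ZMod 2) (fun p => Quotient.mk st (q p))
  have hL : Function.Injective L := by
    apply LinearMap.funLeft_injective_of_surjective
    exact Quotient.mk_surjective.comp hq
  have hr : LinearMap.range L = invSub π σ (fun d => S (c d)) ⊓ facSub q := by
    apply le_antisymm
    · rintro _ ⟨g, rfl⟩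
      refine ⟨fun d hd => ?_, fun p p' hp => ?_⟩
      · change g _ = g _
        congr 1
        exact Quotient.sound (Relation.EqvGen.rel _ _ ⟨c d, hd, hends d⟩)
      · change g _ = g _
        simp only [hp]
    · rintro h ⟨h1, h2⟩
      let g0 : V → ZMod 2 := fun v => h (Function.surjInv hq v)
      have hg0 : ∀ p, g0 (q p) = h p := fun p => h2 _ _ (Function.surjInv_eq hq _)
      have hg1 : ∀ a b, Relation.EqvGen (fun u v : V => ∃ e, S e ∧ ends e = s(u, v)) a b →
          g0 a = g0 b := by
        intro a b hab
        induction hab with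
        | rel x y hxy =>
          obtain ⟨e, he, hxy⟩ := hxy
          obtain ⟨d, rfl⟩ := hc e
          rw [hends, Sym2.eq_iff] at hxy
          have := h1 d he
          rw [← hg0, ← hg0] at this
          rcases hxy with ⟨rfl, rfl⟩ | ⟨rfl, rfl⟩
          · exact this
          · exact this.symm
        | refl x => rfl
        | symm x y _ ih => exact ih.symm
        | trans x y z _ _ i1 i2 => exact i1.trans i2
      refine ⟨Quotient.lift g0 hg1, ?_⟩
      ext p
      exact hg0 p
  rw [← hr, LinearMap.finrank_range_of_inj hL, Module.finrank_fintype_fun_eq_card,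
    multigraphComponents, Nat.card_eq_fintype_card]

lemma deg_eq {D V E : Type*} [Fintype D] [Fintype E] [DecidableEq V] (σ : D ≃ D)
    (w : D → V) (ends : E → Sym2 V) (c : D → E) (hc : Function.Bijective c)
    (hends : ∀ d, ends (c d) = s(w d, w (σ d))) (color : E → Bool)
    (hcol : ∀ d, color (c (σ d)) = !color (c d)) (v : V) :
    multigraphDeg ends (fun e => color e = true) v = Fintype.card {d // w d = v} := by
  rw [multigraphDeg, ← hc.sum_comp, Fintype.card_subtype, Finset.card_filter]
  have h1 : ∀ d, (if w d = v then 1 else 0) =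
      (if color (c d) = true then (if w d = v then 1 else 0) else 0) +
      (if color (c d) = true then 0 else (if w d = v then 1 else 0)) := by
    intro d; split_ifs <;> simp
  rw [Finset.sum_congr rfl fun d _ => h1 d, Finset.sum_add_distrib,
    ← σ.sum_comp (fun d => if color (c d) = true then 0 else (if w d = v then 1 else 0)),
    ← Finset.sum_add_distrib]
  refine Finset.sum_congr rfl fun d _ => ?_
  simp only [hends, hcol, Sym2.eq_iff, Sym2.mem_iff]
  cases color (c d)
  · simp
  · by_cases a : w d = v <;> by_cases b : w (σ d) = v <;> simp [a, b, eq_comm] <;> grind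

lemma exists_pairing {D V : Type*} [Fintype D] [Fintype V] [DecidableEq V] (w : D → V)
    (hw : ∀ v, Fintype.card {d // w d = v} ≠ 0 ∧ Even (Fintype.card {d // w d = v})) :
    ∃ (k : V → ℕ) (e : D ≃ (Σ v, Fin (k v)) × Bool),
      (∀ d, (e d).1.1 = w d) ∧ ∀ v, k v ≠ 0 := by
  choose k hk using fun v => (hw v).2
  have h : ∀ v, Nonempty ({d // w d = v} ≃ Fin (k v) × Bool) := fun v =>
    ⟨Fintype.equivOfCardEq (by simp [hk]; ring)⟩
  refine ⟨k, (Equiv.sigmaFiberEquiv w).symm.trans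
    ((Equiv.sigmaCongrRight fun v => (h v).some).trans
      (Equiv.sigmaProdDistrib (fun v => Fin (k v)) Bool).symm), ?_, ?_⟩
  · intro d
    rfl
  · intro v hv
    exact (hw v).1 (by rw [hk, hv])

end Helpers

/-- let `G = (V, E)` be a finite multigraph with a two-coloring
of the edges into red (`color e = true`) and blue, such that every vertex has
nonzero even degree in each monochromatic subgraph, and such that the edge set
decomposes into `m` disjoint nonempty cycles of even lengths `2·len a`, whose
edges alternate between red and blue.  Then
`c(G_R) + c(G_B) ≤ |E|/2 - m + 2·c(G)`. -/
theorem alternating_cycle_component_bound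
    {V E : Type*} [Fintype V] [Fintype E] [DecidableEq V] [DecidableEq E]
    (ends : E → Sym2 V) (color : E → Bool)
    (hRdeg : ∀ v : V, multigraphDeg ends (fun e => color e = true) v ≠ 0 ∧
      Even (multigraphDeg ends (fun e => color e = true) v))
    (hBdeg : ∀ v : V, multigraphDeg ends (fun e => color e = false) v ≠ 0 ∧
      Even (multigraphDeg ends (fun e => color e = false) v))
    (m : ℕ) (len : Fin m → ℕ) (hlen : ∀ a, 1 ≤ len a)
    (c : (a : Fin m) → Fin (2 * len a) → E)
    (w : (a : Fin m) → Fin (2 * len a) → V)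
    (hcycle : ∀ (a : Fin m) (i : Fin (2 * len a)),
      ends (c a i) =
        s(w a i, w a ⟨(i.val + 1) % (2 * len a),
          Nat.mod_lt _ (by have := hlen a; omega)⟩))
    (halt : ∀ (a : Fin m) (i : Fin (2 * len a)),
      color (c a i) = decide (i.val % 2 = 0))
    (hdisj : Function.Bijective
      (fun p : (a : Fin m) × Fin (2 * len a) => c p.1 p.2)) :
    (multigraphComponents ends (fun e => color e = true) : ℚ) +
        multigraphComponents ends (fun e => color e = false) ≤
      (Fintype.card E : ℚ) / 2 - m +
        2 * multigraphComponents ends (fun _ => True) := by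
  classical
  let D := (a : Fin m) × Fin (2 * len a)
  let nx : D → D := fun d => ⟨d.1, ⟨(d.2.val + 1) % (2 * len d.1),
          Nat.mod_lt _ (by have := hlen d.1; omega)⟩⟩
  have hmod : ∀ d : D, (d.2.val + 1 < 2 * len d.1 ∧ (nx d).2.val = d.2.val + 1) ∨
      (d.2.val + 1 = 2 * len d.1 ∧ (nx d).2.val = 0) := by
    intro d
    have h1 := d.2.isLt
    rcases Nat.lt_or_ge (d.2.val + 1) (2 * len d.1) with h | h
    · exact Or.inl ⟨h, Nat.mod_eq_of_lt h⟩
    · have h2 : d.2.val + 1 = 2 * len d.1 := by omega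
      refine Or.inr ⟨h2, ?_⟩
      change (d.2.val + 1) % (2 * len d.1) = 0
      rw [h2, Nat.mod_self]
  have hinj : Function.Injective nx := by
    rintro ⟨a, i⟩ ⟨b, j⟩ h
    have hab : a = b := congrArg Sigma.fst h
    subst hab
    have h2 : (nx ⟨a, i⟩).2.val = (nx ⟨a, j⟩).2.val := by rw [h]
    have hi := hmod ⟨a, i⟩
    have hj := hmod ⟨a, j⟩
    have : i = j := by
      apply Fin.ext
      simp only at hi hj
      omega
    rw [this]
  let σ : D ≃ D := Equiv.ofBijective nx (Finite.injective_iff_bijective.1 hinj)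
  let cc : D → E := fun p => c p.1 p.2
  let ww : D → V := fun p => w p.1 p.2
  have hends : ∀ d, ends (cc d) = s(ww d, ww (σ d)) := fun d => hcycle d.1 d.2
  have hcol : ∀ d, color (cc (σ d)) = !color (cc d) := by
    intro d
    have h1 : color (cc (σ d)) = decide ((nx d).2.val % 2 = 0) := halt _ _
    have h2 : color (cc d) = decide (d.2.val % 2 = 0) := halt _ _
    rw [h1, h2, ← decide_not, decide_eq_decide]
    have := hmod d
    omega
  have hdeg := deg_eq σ ww ends cc hdisj hends color hcol
  obtain ⟨k, e, he, hk⟩ := exists_pairing ww (fun v => by rw [← hdeg]; exact hRdeg v)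
  have hφs : Function.Surjective (fun d : D => d.1) := fun a =>
    ⟨⟨a, ⟨0, by have := hlen a; omega⟩⟩, rfl⟩
  have hcore := core e σ (fun d : D => d.1) hφs (fun d => rfl) (fun d => color (cc d)) hcol
    (facSub (fun p : (Σ v, Fin (k v)) => p.1))
  have hq : Function.Surjective (fun p : (Σ v, Fin (k v)) => p.1) := fun v =>
    ⟨⟨v, ⟨0, Nat.pos_of_ne_zero (hk v)⟩⟩, rfl⟩
  have hcomp := comp_finrank (fun d => (e d).1) σ _ hq ends cc hdisj.2
    (fun d => by rw [hends]; simp only [he])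
  have h1 := hcomp (fun e => color e = true)
  have h2 := hcomp (fun e => color e = false)
  have h3 := hcomp (fun _ => True)
  rw [← h1, ← h2, ← h3, Fintype.card_fin] at hcore
  have hcard : Fintype.card E = 2 * Fintype.card (Σ v, Fin (k v)) := by
    rw [← Fintype.card_of_bijective hdisj, Fintype.card_congr e, Fintype.card_prod,
      Fintype.card_bool, mul_comm]
  rw [hcard]
  have hQ : ((multigraphComponents ends (fun e => color e = true) +
        multigraphComponents ends (fun e => color e = false) + m : ℕ) : ℚ) ≤
      ((Fintype.card (Σ v, Fin (k v)) + 2 * multigraphComponents ends (fun _ => True) : ℕ) : ℚ) :=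
    Nat.cast_le.2 hcore
  push_cast at hQ ⊢
  linarith
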